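/- Let n ≥ 1 and let v = (v_1, …, v_n) ∈ ℝ^n satisfy v_1 > v_2 > … > v_n and v_i − v_{i+1} > n(v_{i+1} − v_n) for all 1 ≤ i < n. Let σ be a permutation of [n] with one-line notation σ_1σ_2…σ_n, and let C_σ = {x ∈ ℝ^n : x_{σ_1} ≥ x_{σ_2} ≥ … ≥ x_{σ_n}} be the closed region of the braid arrangement labeled by σ. If p ∈ C_σ is the unique point of C_σ minimizing the Euclidean distance to v, then the number of distinct values among the coordinates p_1, …, p_n equals RLmin(σ), the number of right-to-left minima of σ. -/

import Mathlib

open Classical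

/-- First-order optimality at an antitone least-squares fit `q` of `w`: directions `f` which keep
`q` antitone to first order have nonpositive pairing with the residual. -/
lemma sum_residual_mul_nonpos {ι : Type*} [Fintype ι] [Preorder ι] {w q f : ι → ℝ}
    (hq : Antitone q)
    (hmin : ∀ y : ι → ℝ, Antitone y → ∑ t, (w t - q t) ^ 2 ≤ ∑ t, (w t - y t) ^ 2)
    (hf : ∀ s t, s ≤ t → q s = q t → f t ≤ f s) :
    ∑ t, (w t - q t) * f t ≤ 0 := by
  have hanti : ∀ᶠ ε : ℝ in nhdsWithin 0 (Set.Ioi 0), Antitone fun t => q t + ε * f t := by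
    have h : ∀ᶠ ε : ℝ in nhdsWithin 0 (Set.Ioi 0),
        ∀ s t, s ≤ t → q t + ε * f t ≤ q s + ε * f s := by
      simp only [Filter.eventually_all]
      intro s t hst
      rcases (hq hst).eq_or_lt with h | h
      · filter_upwards [self_mem_nhdsWithin] with ε hε
        have := mul_le_mul_of_nonneg_left (hf s t hst h.symm) (le_of_lt hε)
        linarith
      · have hc : Continuous fun ε : ℝ => (q s + ε * f s) - (q t + ε * f t) := by fun_prop
        have h0 := (hc.tendsto 0).eventually (lt_mem_nhds (a := 0) (by simpa using h))
        filter_upwards [h0.filter_mono nhdsWithin_le_nhds] with ε hε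
        linarith
    exact h.mono fun ε hε s t hst => hε s t hst
  have hle : ∀ᶠ ε : ℝ in nhdsWithin 0 (Set.Ioi 0),
      2 * ∑ t, (w t - q t) * f t ≤ ε * ∑ t, f t ^ 2 := by
    filter_upwards [hanti, self_mem_nhdsWithin] with ε hε hpos
    have hexp : ∑ t, (w t - (q t + ε * f t)) ^ 2 =
        ∑ t, (w t - q t) ^ 2 - ε * (2 * ∑ t, (w t - q t) * f t) + ε * (ε * ∑ t, f t ^ 2) := by
      simp only [Finset.mul_sum]
      rw [← Finset.sum_sub_distrib, ← Finset.sum_add_distrib]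
      exact Finset.sum_congr rfl fun t _ => by ring
    have := hmin _ hε
    exact le_of_mul_le_mul_left (by linarith) hpos
  have hlim : Filter.Tendsto (fun ε : ℝ => ε * ∑ t, f t ^ 2) (nhdsWithin 0 (Set.Ioi 0))
      (nhds 0) := by
    have hc : Continuous fun ε : ℝ => ε * ∑ t, f t ^ 2 := by fun_prop
    simpa using (hc.tendsto 0).mono_left nhdsWithin_le_nhds
  linarith [ge_of_tendsto hlim hle]

/-- The number of values of `q` is the number of indices that are the last with their value. -/
lemma card_image_eq_card_filter_last {ι β : Type*} [Fintype ι] [LinearOrder ι] (q : ι → β) :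
    (Finset.univ.image q).card =
      (Finset.univ.filter fun i : ι => ∀ j, i < j → q j ≠ q i).card := by
  have himage : Finset.univ.image q =
      (Finset.univ.filter fun i : ι => ∀ j, i < j → q j ≠ q i).image q := by
    refine subset_antisymm ?_ (Finset.image_subset_image (Finset.filter_subset _ _))
    intro c hc
    obtain ⟨i, -, rfl⟩ := Finset.mem_image.mp hc
    obtain ⟨m, hm, hmax⟩ := (Finset.univ.filter fun j => q j = q i).exists_max_image id
      ⟨i, by simp⟩
    simp only [Finset.mem_filter, Finset.mem_univ, true_and, id] at hm hmax
    refine Finset.mem_image.mpr ⟨m, ?_, hm⟩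
    simp only [Finset.mem_filter, Finset.mem_univ, true_and]
    exact fun j hj h => (hmax j (h.trans hm)).not_gt hj
  rw [himage, Finset.card_image_of_injOn]
  intro i hi j hj hij
  simp only [Finset.coe_filter, Finset.mem_univ, true_and, Set.mem_ofPred_eq] at hi hj
  rcases lt_trichotomy i j with h | h | h
  · exact absurd hij.symm (hi j h)
  · exact h
  · exact absurd hij (hj i h)

/-- If `w` is bounded below by `m` and each value of `w` exceeds the smaller ones by the factor
`card ι` (measured from `m`), then an index is the last one in its level set of the antitone
least-squares fit of `w` exactly when its value exceeds all later ones. -/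
lemma last_in_level_iff_of_dominating {ι : Type*} [Fintype ι] [LinearOrder ι] {w q : ι → ℝ}
    {m : ℝ} (hm : ∀ t, m ≤ w t)
    (hw : ∀ s t, w t < w s → Fintype.card ι * (w t - m) < w s - m)
    (hinj : Function.Injective w) (hq : Antitone q)
    (hmin : ∀ y : ι → ℝ, Antitone y → ∑ t, (w t - q t) ^ 2 ≤ ∑ t, (w t - y t) ^ 2) (s : ι) :
    (∀ t, s < t → q t ≠ q s) ↔ ∀ t, s < t → w t < w s := by
  have hcard : ∀ (I : Finset ι) (t : ι), I.card * (w t - m) ≤ Fintype.card ι * (w t - m) :=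
    fun I t => mul_le_mul_of_nonneg_right (by exact_mod_cast I.card_le_univ)
      (sub_nonneg.mpr (hm t))
  have hlower : ∀ (I : Finset ι) (t : ι), t ∈ I → w t - m ≤ ∑ i ∈ I, (w i - m) :=
    fun I t ht => Finset.single_le_sum (f := fun i => w i - m)
      (fun i _ => sub_nonneg.mpr (hm i)) ht
  constructor
  · intro hlast a hsa
    by_contra! hle
    have hlt : w s < w a := hle.lt_of_ne fun h => hsa.ne (hinj h)
    have hqs : q s ≤ w s := by
      have := sum_residual_mul_nonpos (f := fun t => if t = s then -1 else 0) hq hmin (by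
        intro i j hij h
        by_cases hi : i = s
        · subst hi
          have : j = i := by
            by_contra hne
            exact hlast j (lt_of_le_of_ne hij (Ne.symm hne)) h.symm
          simp [this]
        · simp only [hi, if_false]
          split_ifs <;> norm_num)
      simp only [mul_ite, mul_zero, Finset.sum_ite_eq', Finset.mem_univ, if_true] at this
      linarith
    set I := Finset.univ.filter fun t => s < t ∧ t ≤ a with hI
    have hsum : ∑ t ∈ I, (w t - q t) ≤ 0 := by
      have := sum_residual_mul_nonpos (f := fun t => if s < t ∧ t ≤ a then 1 else 0) hq hmin (by
        intro i j hij h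
        by_cases hj : s < j ∧ j ≤ a
        · have hi : s < i := by
            by_contra! hi
            exact hlast j hj.1 (le_antisymm (hq hj.1.le) (h ▸ hq hi))
          simp [hj, hi, hij.trans hj.2]
        · simp only [hj, if_false]
          split_ifs <;> norm_num)
      simpa only [hI, Finset.sum_filter, mul_ite, mul_one, mul_zero] using this
    have hupper : ∑ t ∈ I, (q t - m) ≤ I.card * (w s - m) := by
      rw [← nsmul_eq_mul]
      refine Finset.sum_le_card_nsmul _ _ _ fun t ht => ?_
      have := hq (Finset.mem_filter.mp ht).2.1.le
      linarith
    have hsplit : ∑ t ∈ I, (w t - m) = ∑ t ∈ I, (w t - q t) + ∑ t ∈ I, (q t - m) := by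
      rw [← Finset.sum_add_distrib]
      exact Finset.sum_congr rfl fun t _ => by ring
    linarith [hlower I a (by simp [hI, hsa]), hcard I s, hw a s hlt]
  · intro hdom b hsb hqb
    set D := Finset.univ.filter fun t => t ≤ s ∧ q t = q s with hD
    set E := Finset.univ.filter fun t => s < t ∧ q t = q s with hE
    have hDsum : ∑ t ∈ D, (w t - q t) ≤ 0 := by
      have := sum_residual_mul_nonpos (f := fun t => if t ≤ s ∧ q t = q s then 1 else 0) hq hmin (by
        intro i j hij h
        by_cases hj : j ≤ s ∧ q j = q s
        · simp [hj, hij.trans hj.1, h]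
        · simp only [hj, if_false]
          split_ifs <;> norm_num)
      simpa only [hD, Finset.sum_filter, mul_ite, mul_one, mul_zero] using this
    have hEsum : 0 ≤ ∑ t ∈ E, (w t - q t) := by
      have := sum_residual_mul_nonpos (f := fun t => if s < t ∧ q t = q s then -1 else 0) hq hmin
        (by
          intro i j hij h
          by_cases hi : s < i ∧ q i = q s
          · simp [hi, hi.1.trans_le hij, ← h]
          · simp only [hi, if_false]
            split_ifs <;> norm_num)
      simp only [mul_ite, mul_zero, mul_neg, mul_one, ← Finset.sum_filter,
        Finset.sum_neg_distrib] at this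
      linarith
    obtain ⟨t, htE, ht⟩ : ∃ t ∈ E, 0 ≤ w t - q t :=
      Finset.exists_le_of_sum_le (f := fun _ => (0 : ℝ)) ⟨b, by simp [hE, hsb, hqb]⟩
        (by simpa using hEsum)
    obtain ⟨hst, hqt⟩ : s < t ∧ q t = q s := by simpa [hE] using htE
    have hupper : ∑ i ∈ D, (q i - m) ≤ D.card * (w t - m) := by
      rw [← nsmul_eq_mul]
      refine Finset.sum_le_card_nsmul _ _ _ fun i hi => ?_
      have := (Finset.mem_filter.mp hi).2.2
      linarith
    have hsplit : ∑ t ∈ D, (w t - m) = ∑ t ∈ D, (w t - q t) + ∑ t ∈ D, (q t - m) := by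
      rw [← Finset.sum_add_distrib]
      exact Finset.sum_congr rfl fun t _ => by ring
    linarith [hlower D s (by simp [hD]), hcard D t, hw s t (hdom t hst)]

/-- For `v` with `v₁ > ⋯ > vₙ` and `vᵢ − vᵢ₊₁ > n(vᵢ₊₁ − vₙ)`,
the nearest point `p` of the closed braid region `C_σ` to `v` has exactly
`RLmin σ` distinct coordinate values. -/
theorem braid_projection_RLmin {n : ℕ} (hn : 1 ≤ n)
    (v : EuclideanSpace ℝ (Fin n))
    (hv1 : ∀ i j : Fin n, i < j → v j < v i)
    (hv2 : ∀ i : ℕ, ∀ h : i + 1 < n,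
      (n : ℝ) * (v ⟨i + 1, h⟩ - v ⟨n - 1, by omega⟩) < v ⟨i, by omega⟩ - v ⟨i + 1, h⟩)
    (σ : Equiv.Perm (Fin n)) (p : EuclideanSpace ℝ (Fin n))
    (hp : ∀ s t : Fin n, s ≤ t → p (σ t) ≤ p (σ s))
    (hmin : ∀ x : EuclideanSpace ℝ (Fin n),
      (∀ s t : Fin n, s ≤ t → x (σ t) ≤ x (σ s)) → dist v p ≤ dist v x) :
    (Finset.univ.image fun i : Fin n => p i).card =
      (Finset.univ.filter fun i : Fin n => ∀ j : Fin n, i < j → σ i < σ j).card := by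
  have hanti : StrictAnti v := fun i j h => hv1 i j h
  have hlast : ∀ j : Fin n, v ⟨n - 1, by omega⟩ ≤ v j := fun j =>
    hanti.antitone (Fin.le_def.mpr (by simp only; omega))
  have hgap : ∀ i j : Fin n, i < j →
      (n : ℝ) * (v j - v ⟨n - 1, by omega⟩) < v i - v ⟨n - 1, by omega⟩ := by
    intro i j hij
    have hi : (i : ℕ) + 1 < n := by have := Fin.lt_def.mp hij; omega
    have hji : v j ≤ v ⟨i + 1, hi⟩ := hanti.antitone (Fin.le_def.mpr (Fin.lt_def.mp hij))
    have hmul : (n : ℝ) * (v j - v ⟨n - 1, by omega⟩) ≤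
        n * (v ⟨i + 1, hi⟩ - v ⟨n - 1, by omega⟩) :=
      mul_le_mul_of_nonneg_left (by linarith) n.cast_nonneg
    have h := hv2 i hi
    simp only [Fin.eta] at h
    linarith [hlast ⟨i + 1, hi⟩]
  have hfit : ∀ y : Fin n → ℝ, Antitone y →
      ∑ t, (v (σ t) - p (σ t)) ^ 2 ≤ ∑ t, (v (σ t) - y t) ^ 2 := by
    intro y hy
    have h := hmin (WithLp.toLp 2 fun i => y (σ.symm i)) fun s t hst => by simpa using hy hst
    rw [EuclideanSpace.dist_eq, EuclideanSpace.dist_eq,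
      Real.sqrt_le_sqrt_iff (Finset.sum_nonneg fun _ _ => sq_nonneg _)] at h
    simp only [Real.dist_eq, sq_abs] at h
    rw [← Equiv.sum_comp σ, ← Equiv.sum_comp σ (fun i => (v i - y (σ.symm i)) ^ 2)] at h
    simpa using h
  have himage : (Finset.univ.image fun i : Fin n => p i) =
      Finset.univ.image fun t : Fin n => p (σ t) := by
    ext c
    simp only [Finset.mem_image, Finset.mem_univ, true_and]
    exact σ.surjective.exists
  rw [himage]
  refine (card_image_eq_card_filter_last _).trans (congrArg Finset.card ?_)
  ext s
  simp only [Finset.mem_filter, Finset.mem_univ, true_and]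
  rw [last_in_level_iff_of_dominating (w := fun t => v (σ t)) (q := fun t => p (σ t))
    (fun t => hlast (σ t))
    (fun s t h => by simpa using hgap _ _ (hanti.lt_iff_gt.mp h))
    (hanti.injective.comp σ.injective) (fun s t hst => hp s t hst) hfit s]
  simp only [hanti.lt_iff_gt]
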